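/- Let 1 ≤ n ≤ 4 and let Λ = ℤⁿ with B(x,y) = −2(x·y) (the lattice nA₁). Then every class of Λ/2Λ lies in the radical R, and a class v with q₀(v) = 1 lies outside R₁ if and only if v is the class of one of the standard basis vectors e₁, …, eₙ; there are exactly n such classes, and the elements of Λ with B(e,e) = −2 are exactly ±e₁, …, ±eₙ. -/

import Mathlib

open Matrix

/-- The bilinear form of the lattice `nA₁` on `ℤⁿ`: `B x y = -2 (x · y)`. -/
def A1form (n : ℕ) (x y : Fin n → ℤ) : ℤ := -(2 * (x ⬝ᵥ y))

/-- The submodule `2Λ ⊆ Λ`. -/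
def twoSub (M : Type*) [AddCommGroup M] [Module ℤ M] : Submodule ℤ M :=
  LinearMap.range ((2 : ℤ) • (LinearMap.id : M →ₗ[ℤ] M))

/-- The quotient `Λ/2Λ` for `nA₁`. -/
abbrev Vn (n : ℕ) : Type := (Fin n → ℤ) ⧸ twoSub (Fin n → ℤ)

/-- `q₀(c) = 1`: the class `c` has a representative `v` with `B v v / 2` odd. -/
def q0one (n : ℕ) (c : Vn n) : Prop :=
  ∃ v : Fin n → ℤ, Submodule.Quotient.mk v = c ∧ (A1form n v v / 2) % 2 = 1

/-- `c` lies in the radical `R`. -/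
def inRad (n : ℕ) (c : Vn n) : Prop :=
  ∃ v : Fin n → ℤ, Submodule.Quotient.mk v = c ∧ ∀ w : Fin n → ℤ, (2 : ℤ) ∣ A1form n v w

/-- `c ∈ R₁`: `c` lies in the radical and `q(c) = 1 ∈ ℤ/4`. -/
def inR1 (n : ℕ) (c : Vn n) : Prop :=
  ∃ v : Fin n → ℤ, Submodule.Quotient.mk v = c ∧
    (∀ w : Fin n → ℤ, (2 : ℤ) ∣ A1form n v w) ∧ (A1form n v v / 2) % 4 = 1

/-- `c` is the class of a standard basis vector. -/
def isBasisClass (n : ℕ) (c : Vn n) : Prop :=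
  ∃ i : Fin n, Submodule.Quotient.mk (Pi.single i (1 : ℤ)) = c

/-- The set of coordinates at which an integer vector is odd. -/
def oddSupport {n : ℕ} (v : Fin n → ℤ) : Finset (Fin n) :=
  Finset.univ.filter fun i => v i % 2 = 1

theorem mem_oddSupport {n : ℕ} {v : Fin n → ℤ} {i : Fin n} :
    i ∈ oddSupport v ↔ v i % 2 = 1 := by
  simp [oddSupport]

theorem mk_eq_mk_iff_oddSupport_eq {n : ℕ} {u v : Fin n → ℤ} :
    (Submodule.Quotient.mk u : Vn n) = Submodule.Quotient.mk v ↔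
      oddSupport u = oddSupport v := by
  rw [Submodule.Quotient.eq, twoSub, LinearMap.mem_range, Finset.ext_iff]
  simp only [mem_oddSupport]
  constructor
  · rintro ⟨y, hy⟩ i
    have hi := congrFun hy i
    simp at hi
    omega
  · intro h
    refine ⟨fun i => (u i - v i) / 2, funext fun i => ?_⟩
    have hi := h i
    simp
    omega

theorem oddSupport_single {n : ℕ} (i : Fin n) :
    oddSupport (Pi.single i (1 : ℤ)) = {i} := by
  ext j
  rw [mem_oddSupport, Finset.mem_singleton, Pi.single_apply]
  split_ifs with h <;> simp [h]

theorem isBasisClass_mk_iff {n : ℕ} (v : Fin n → ℤ) :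
    isBasisClass n (Submodule.Quotient.mk v) ↔ (oddSupport v).card = 1 := by
  simp only [isBasisClass, mk_eq_mk_iff_oddSupport_eq, oddSupport_single, Finset.card_eq_one,
    eq_comm]

theorem A1form_self_div_two {n : ℕ} (v : Fin n → ℤ) : A1form n v v / 2 = -(v ⬝ᵥ v) := by
  unfold A1form
  omega

theorem dotProduct_self_modEq_card_oddSupport {n : ℕ} (v : Fin n → ℤ) :
    v ⬝ᵥ v ≡ (oddSupport v).card [ZMOD 4] := by
  have h : ((oddSupport v).card : ℤ) = ∑ i, if v i % 2 = 1 then 1 else 0 := by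
    simp [oddSupport]
  rw [h, dotProduct]
  refine Int.ModEq.sum fun i _ => ?_
  rcases Int.even_or_odd' (v i) with ⟨k, hk | hk⟩
  · rw [if_neg (by omega), hk, Int.modEq_zero_iff_dvd]
    exact ⟨k * k, by ring⟩
  · rw [if_pos (by omega), hk]
    exact (Int.modEq_iff_dvd.2 ⟨k * k + k, by ring⟩).symm

theorem two_dvd_A1form {n : ℕ} (v w : Fin n → ℤ) : 2 ∣ A1form n v w :=
  (Dvd.intro _ rfl).neg_right

theorem card_oddSupport_le {n : ℕ} (v : Fin n → ℤ) : (oddSupport v).card ≤ n := by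
  simpa using Finset.card_le_univ (oddSupport v)

theorem q0one_mk_iff {n : ℕ} (v : Fin n → ℤ) :
    q0one n (Submodule.Quotient.mk v) ↔ (oddSupport v).card % 2 = 1 := by
  simp only [q0one, mk_eq_mk_iff_oddSupport_eq, A1form_self_div_two]
  constructor
  · rintro ⟨u, hu, h⟩
    have := dotProduct_self_modEq_card_oddSupport u
    rw [hu, Int.ModEq] at this
    omega
  · intro h
    have := dotProduct_self_modEq_card_oddSupport v
    rw [Int.ModEq] at this
    exact ⟨v, rfl, by omega⟩

theorem inR1_mk_iff {n : ℕ} (v : Fin n → ℤ) :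
    inR1 n (Submodule.Quotient.mk v) ↔ (oddSupport v).card % 4 = 3 := by
  simp only [inR1, mk_eq_mk_iff_oddSupport_eq, A1form_self_div_two]
  constructor
  · rintro ⟨u, hu, -, h⟩
    have := dotProduct_self_modEq_card_oddSupport u
    rw [hu, Int.ModEq] at this
    omega
  · intro h
    have := dotProduct_self_modEq_card_oddSupport v
    rw [Int.ModEq] at this
    exact ⟨v, rfl, two_dvd_A1form v, by omega⟩

theorem card_isBasisClass (n : ℕ) : Nat.card {c : Vn n // isBasisClass n c} = n := by
  have hinj : Function.Injective
      fun i : Fin n => (Submodule.Quotient.mk (Pi.single i (1 : ℤ)) : Vn n) := by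
    intro i j hij
    simpa [mk_eq_mk_iff_oddSupport_eq, oddSupport_single] using hij
  exact (Nat.card_congr (Equiv.ofInjective _ hinj)).symm.trans (Nat.card_fin n)

theorem dotProduct_self_eq_one_iff {n : ℕ} (e : Fin n → ℤ) :
    e ⬝ᵥ e = 1 ↔ ∃ i : Fin n, e = Pi.single i (1 : ℤ) ∨ e = -(Pi.single i (1 : ℤ)) := by
  constructor
  · intro h
    obtain ⟨i, hi⟩ : ∃ i, e i ≠ 0 := by
      by_contra! h0
      simp [dotProduct, h0] at h
    have hsum : e i * e i + ∑ j ∈ Finset.univ.erase i, e j * e j = 1 := by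
      rw [Finset.add_sum_erase _ (fun j => e j * e j) (Finset.mem_univ i)]
      exact h
    have hnonneg : ∀ j ∈ Finset.univ.erase i, 0 ≤ e j * e j := fun j _ => mul_self_nonneg _
    have hrest := Finset.sum_nonneg hnonneg
    have hpos : 0 < e i * e i := mul_self_pos.2 hi
    have hzero : ∀ j, j ≠ i → e j = 0 := fun j hj =>
      mul_self_eq_zero.1 ((Finset.sum_eq_zero_iff_of_nonneg hnonneg).1 (by omega) j
        (Finset.mem_erase.2 ⟨hj, Finset.mem_univ j⟩))
    have he : e = Pi.single i (e i) := by
      ext j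
      by_cases hj : j = i
      · subst hj; simp
      · simp [hj, hzero j hj]
    refine ⟨i, (mul_self_eq_one_iff.1 (show e i * e i = 1 by omega)).imp ?_ ?_⟩
    · intro h1
      rwa [h1] at he
    · intro h1
      rwa [h1, Pi.single_neg] at he
  · rintro ⟨i, rfl | rfl⟩ <;> simp

/-- For `Λ = nA₁` with `1 ≤ n ≤ 4`: every class of `Λ/2Λ` lies in
the radical; a class with `q₀ = 1` lies outside `R₁` iff it is the class of a
standard basis vector; there are exactly `n` such classes; and the vectors of
square `-2` are exactly `±e₁, …, ±eₙ`. -/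
theorem stmt_9 (n : ℕ) (h1 : 1 ≤ n) (h4 : n ≤ 4) :
    (∀ c : Vn n, inRad n c) ∧
    (∀ c : Vn n, q0one n c → (¬ inR1 n c ↔ isBasisClass n c)) ∧
    Nat.card {c : Vn n // isBasisClass n c} = n ∧
    (∀ e : Fin n → ℤ, A1form n e e = -2 ↔
      ∃ i : Fin n, e = Pi.single i (1 : ℤ) ∨ e = -(Pi.single i (1 : ℤ))) := by
  refine ⟨fun c => ?_, fun c => ?_, card_isBasisClass n, fun e => ?_⟩
  · obtain ⟨v, rfl⟩ := Submodule.Quotient.mk_surjective _ c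
    exact ⟨v, rfl, two_dvd_A1form v⟩
  · obtain ⟨v, rfl⟩ := Submodule.Quotient.mk_surjective _ c
    rw [q0one_mk_iff, inR1_mk_iff, isBasisClass_mk_iff]
    have := card_oddSupport_le v
    omega
  · rw [← dotProduct_self_eq_one_iff, A1form]
    omega
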